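/- For every natural number n, the total number of non-overlapping set partitions of [n] = {1,…,n} (the n-th Bessel number B*_n) equals the value at u = 1 of the polynomial F_{n+1} ∈ Polynomial ℚ, where F_1 = u and F_{m+1} = u·F_m' + Σ_{s=1}^{m−1} F_s·F_{m−s}. -/

import Mathlib

open Finset Polynomial

attribute [local instance] Classical.propDecidable

/-- Two finsets `α`, `β` of `Fin n` overlap if `min α < min β < max α < max β`. -/
def Overlap {n : ℕ} (α β : Finset (Fin n)) : Prop :=
  ∃ (hα : α.Nonempty) (hβ : β.Nonempty),
    α.min' hα < β.min' hβ ∧ β.min' hβ < α.max' hα ∧ α.max' hα < β.max' hβ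

/-- A set partition is non-overlapping (a NOP) if no two of its blocks overlap. -/
def IsNOP {n : ℕ} (π : Finpartition (univ : Finset (Fin n))) : Prop :=
  ∀ α ∈ π.parts, ∀ β ∈ π.parts, ¬ Overlap α β

noncomputable def mz : ℕ → ℕ → ℚ[X]
  | 0, _ => 1
  | 1, c => ((c + 1 : ℕ) : ℚ[X])
  | n + 2, c => ((c + 1 : ℕ) : ℚ[X]) * mz (n + 1) c +
      X * ∑ i : Fin (n + 1), mz i (c + 1) * mz (n - i) c
termination_by n => n
decreasing_by all_goals omega

noncomputable def Mz (c : ℕ) : PowerSeries ℚ[X] := PowerSeries.mk (fun n => mz n c)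

theorem Mz_eq (c : ℕ) : Mz c = 1 + ((c : PowerSeries ℚ[X]) + 1) * PowerSeries.X * Mz c
    + PowerSeries.X ^ 2 * PowerSeries.C (X : ℚ[X]) * Mz (c + 1) * Mz c := by
  have e : ((c : PowerSeries ℚ[X]) + 1) * PowerSeries.X * Mz c =
      PowerSeries.X * (PowerSeries.C ((c + 1 : ℕ) : ℚ[X]) * Mz c) := by
    simp; ring
  have e2 : PowerSeries.X ^ 2 * PowerSeries.C (X : ℚ[X]) * Mz (c + 1) * Mz c =
      PowerSeries.X * (PowerSeries.X * (PowerSeries.C (X : ℚ[X]) * (Mz (c + 1) * Mz c))) := by ring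
  rw [e, e2]
  ext1 n
  match n with
  | 0 => simp [Mz, mz]
  | 1 =>
    rw [map_add, map_add, PowerSeries.coeff_succ_X_mul, PowerSeries.coeff_succ_X_mul]
    simp [Mz, mz, PowerSeries.coeff_one]
  | n + 2 =>
    rw [map_add, map_add, PowerSeries.coeff_succ_X_mul, PowerSeries.coeff_succ_X_mul,
      PowerSeries.coeff_succ_X_mul, PowerSeries.coeff_C_mul, PowerSeries.coeff_C_mul,
      PowerSeries.coeff_mul, Finset.Nat.sum_antidiagonal_eq_sum_range_succ_mk]
    simp only [Mz, PowerSeries.coeff_mk, PowerSeries.coeff_one]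
    rw [mz, Finset.sum_range]
    simp

/-- coefficientwise Euler operator -/
noncomputable def Th (f : PowerSeries ℚ[X]) : PowerSeries ℚ[X] :=
  PowerSeries.mk (fun n => X * derivative (PowerSeries.coeff n f))

theorem Th_add (f g) : Th (f + g) = Th f + Th g := by
  ext1 n; simp [Th, mul_add]

theorem Th_mul (f g) : Th (f * g) = Th f * g + f * Th g := by
  ext1 n
  simp only [Th, PowerSeries.coeff_mul, PowerSeries.coeff_mk, map_add, derivative_sum,
    Finset.mul_sum, ← Finset.sum_add_distrib, derivative_mul]
  refine Finset.sum_congr rfl fun p _ => ?_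
  ring

theorem Th_X : Th PowerSeries.X = 0 := by
  ext1 n; simp only [Th, PowerSeries.coeff_mk, PowerSeries.coeff_X]; split_ifs <;> simp

theorem Th_one : Th 1 = 0 := by
  ext1 n; simp only [Th, PowerSeries.coeff_mk, PowerSeries.coeff_one]; split_ifs <;> simp

theorem Th_natCast (c : ℕ) : Th (c : PowerSeries ℚ[X]) = 0 := by
  induction c with
  | zero => ext1 n; simp [Th]
  | succ c ih => push_cast; rw [Th_add, ih, Th_one, add_zero]

theorem Th_C : Th (PowerSeries.C (X : ℚ[X])) = PowerSeries.C (X : ℚ[X]) := by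
  ext1 n; simp only [Th, PowerSeries.coeff_mk, PowerSeries.coeff_C]; split_ifs <;> simp

theorem Th_Mz (c : ℕ) : Th (Mz c) =
    PowerSeries.X * PowerSeries.C (X : ℚ[X]) * Mz c * (Mz (c + 1) - Mz c) := by
  set D : ℕ → PowerSeries ℚ[X] := fun c => Th (Mz c) -
    PowerSeries.X * PowerSeries.C (X : ℚ[X]) * Mz c * (Mz (c + 1) - Mz c) with hD
  have key : ∀ c, D c = PowerSeries.X * (((c : PowerSeries ℚ[X]) + 1) * D c +
      PowerSeries.X * PowerSeries.C (X : ℚ[X]) * (D (c + 1) * Mz c + Mz (c + 1) * D c)) := by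
    intro c
    have h := congrArg Th (Mz_eq c)
    simp only [Th_add, Th_mul, Th_X, Th_one, Th_natCast, Th_C, pow_two] at h
    have h1 := Mz_eq c
    have h2 := Mz_eq (c + 1)
    push_cast at h2
    simp only [hD]
    linear_combination h +
      PowerSeries.X * PowerSeries.C (X : ℚ[X]) * Mz c * (h1 - h2)
  have dv : ∀ n c, PowerSeries.X ^ n ∣ D c := by
    intro n
    induction n with
    | zero => intro c; simp
    | succ n ih =>
      intro c
      rw [key, pow_succ']
      refine mul_dvd_mul_left _ (dvd_add ((ih c).mul_left _) (Dvd.dvd.mul_left (dvd_add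
        ((ih _).mul_right _) ((ih _).mul_left _)) _))
  have : D c = 0 := by
    ext1 n
    exact (PowerSeries.X_pow_dvd_iff.1 (dv (n + 1) c)) n (by omega)
  exact sub_eq_zero.1 this

theorem F_eq (F : ℕ → Polynomial ℚ)
    (hF1 : F 1 = X)
    (hF : ∀ m, 1 ≤ m →
      F (m + 1) = X * derivative (F m) + ∑ s ∈ Icc 1 (m - 1), F s * F (m - s))
    (n : ℕ) : F (n + 1) = X * mz n 0 := by
  obtain ⟨K, hK⟩ : ∃ K : PowerSeries ℚ[X], K = PowerSeries.C (X : ℚ[X]) * Mz 0 := ⟨_, rfl⟩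
  have hKe : K = PowerSeries.C (X : ℚ[X]) + PowerSeries.X * (Th K + PowerSeries.X * (K * K)) := by
    rw [hK, Th_mul, Th_C, Th_Mz]
    have := Mz_eq 0
    push_cast at this
    linear_combination PowerSeries.C (X : ℚ[X]) * this
  have hKc : ∀ n, PowerSeries.coeff n K = X * mz n 0 := by
    intro n; simp [hK, Mz]
  rw [← hKc]
  induction n using Nat.strong_induction_on with
  | _ n ih =>
  match n with
  | 0 => simp [hKc, mz, hF1]
  | 1 =>
    rw [hKe]
    simp only [map_add, PowerSeries.coeff_succ_X_mul]
    rw [hF 1 le_rfl, hF1]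
    simp [Th, hKc, mz]
  | n + 2 =>
    rw [hKe]
    simp only [map_add, PowerSeries.coeff_succ_X_mul]
    rw [hF _ (by omega), ih _ (by omega), PowerSeries.coeff_mul,
      Finset.Nat.sum_antidiagonal_eq_sum_range_succ_mk]
    simp only [Th, PowerSeries.coeff_mk, PowerSeries.coeff_C]
    rw [if_neg (by omega), zero_add, add_right_inj]
    rw [show n + 1 + 1 - 1 = n + 1 by omega, Finset.range_eq_Ico,
      ← Finset.Ico_add_one_right_eq_Icc, Finset.sum_Ico_eq_sum_range, Finset.range_eq_Ico]
    refine Finset.sum_congr (by simp) fun i hi => ?_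
    have hi' : i < n + 1 := by simpa using hi
    rw [← ih i (by omega), ← ih (n - i) (by omega)]
    congr 2 <;> omega

def Wt : ℕ → ℕ → ℚ
  | 0, h => if h = 0 then 1 else 0
  | n + 1, h => (h + 1) * Wt n h + Wt n (h + 1) + if h = 0 then 0 else Wt n (h - 1)

theorem Wt_eq (n : ℕ) : Wt n 0 = (mz n 0).eval 1 := by
  let E : PowerSeries ℚ[X] →+* PowerSeries ℚ := PowerSeries.map (Polynomial.evalRingHom 1)
  have hE : ∀ c, E (Mz c) = 1 + ((c : PowerSeries ℚ) + 1) * PowerSeries.X * E (Mz c)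
    + PowerSeries.X ^ 2 * E (Mz (c + 1)) * E (Mz c) := by
    intro c
    conv_lhs => rw [Mz_eq]
    simp [E]
  set P : ℕ → PowerSeries ℚ := fun h => PowerSeries.X ^ h * ∏ i ∈ range (h + 1), E (Mz i) with hP
  have h0 : P 0 = 1 + PowerSeries.X * (P 0 + P 1) := by
    simp only [hP, Finset.prod_range_succ]
    have := hE 0
    push_cast at this
    simp
    linear_combination this
  have hs : ∀ h, P (h + 1) = PowerSeries.X * (PowerSeries.C ((h : ℚ) + 1 + 1) * P (h + 1) + P (h + 2) + P h) := by
    intro h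
    simp only [hP, Finset.prod_range_succ]
    have := hE (h + 1)
    push_cast at this
    simp
    linear_combination PowerSeries.X ^ (h + 1) * (∏ i ∈ range h, E (Mz i)) * E (Mz h) * this
  have main : ∀ n h, PowerSeries.coeff n (P h) = Wt n h := by
    intro n
    induction n with
    | zero =>
      intro h
      cases h with
      | zero => rw [h0]; simp [Wt]
      | succ h => rw [hs]; simp [Wt]
    | succ n ih =>
      intro h
      cases h with
      | zero =>
        rw [h0, map_add, PowerSeries.coeff_succ_X_mul, map_add, ih, ih]
        simp [Wt, PowerSeries.coeff_one]
      | succ h =>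
        rw [hs, PowerSeries.coeff_succ_X_mul, map_add, map_add, PowerSeries.coeff_C_mul, ih, ih, ih]
        rw [Wt, if_neg (by omega)]
        push_cast
        rfl
  rw [← main]
  simp [hP, E, Mz]

/-- `f` sends each element to the minimum of its block; `S` is the set of minima of open blocks. -/
structure Good (n : ℕ) (f : ℕ → ℕ) (S : Finset ℕ) : Prop where
  le : ∀ i, f i ≤ i
  idem : ∀ i, f (f i) = f i
  big : ∀ i, n ≤ i → f i = i
  lt : ∀ a ∈ S, a < n
  fixed : ∀ a ∈ S, f a = a
  nov : ∀ a b i, a ∉ S → a < b → b < i → f b = b → f i = a →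
    b ∉ S ∧ ∀ j, i < j → f j = b → ∃ k, j < k ∧ f k = a

theorem Good.c1 {n f S} (h : Good n f S) : Good (n + 1) f S where
  le := h.le
  idem := h.idem
  big i hi := h.big i (by omega)
  lt a ha := by have := h.lt a ha; omega
  fixed := h.fixed
  nov := h.nov

theorem Good.d1 {n f S} (h : Good (n + 1) f S) (h1 : f n = n) (h2 : n ∉ S) : Good n f S where
  le := h.le
  idem := h.idem
  big i hi := by
    rcases hi.eq_or_lt with rfl | hi
    · exact h1
    · exact h.big i hi
  lt a ha := by
    have := h.lt a ha
    have : a ≠ n := fun e => h2 (e ▸ ha)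
    omega
  fixed := h.fixed
  nov := h.nov

theorem Good.c2 {n f S} (h : Good n f S) : Good (n + 1) f (insert n S) where
  le := h.le
  idem := h.idem
  big i hi := h.big i (by omega)
  lt a ha := by
    rcases mem_insert.1 ha with rfl | ha
    · omega
    · have := h.lt a ha; omega
  fixed a ha := by
    rcases mem_insert.1 ha with rfl | ha
    · exact h.big _ le_rfl
    · exact h.fixed a ha
  nov a b i ha hab hbi hb hi := by
    have hin : i < n := by
      by_contra hc
      have := h.big i (by omega)
      omega
    have := h.nov a b i (fun hh => ha (mem_insert_of_mem hh)) hab hbi hb hi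
    refine ⟨?_, this.2⟩
    rw [mem_insert]
    rintro (e | e)
    · omega
    · exact this.1 e

theorem Good.d2 {n f S} (h : Good (n + 1) f S) (h1 : f n = n) : Good n f (S.erase n) where
  le := h.le
  idem := h.idem
  big i hi := by
    rcases hi.eq_or_lt with rfl | hi
    · exact h1
    · exact h.big i hi
  lt a ha := by
    have := h.lt a (mem_of_mem_erase ha)
    have := ne_of_mem_erase ha
    omega
  fixed a ha := h.fixed a (mem_of_mem_erase ha)
  nov a b i ha hab hbi hb hi := by
    have hin : i < n := by
      by_contra hc
      have : f i = i := by
        rcases Nat.lt_or_ge n i with hc' | hc'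
        · exact h.big i (by omega)
        · have : i = n := by omega
          rw [this, h1]
      omega
    have haS : a ∉ S := fun hh => ha (mem_erase.2 ⟨by omega, hh⟩)
    have := h.nov a b i haS hab hbi hb hi
    exact ⟨fun hh => this.1 (mem_of_mem_erase hh), this.2⟩

theorem Good.c3 {n f S a} (h : Good n f S) (ha : a ∈ S) : Good (n + 1) (Function.update f n a) S := by
  have han := h.lt a ha
  have hfa := h.fixed a ha
  refine ⟨?_, ?_, ?_, ?_, ?_, ?_⟩
  · intro i
    rw [Function.update_apply]; split_ifs with e
    · omega
    · exact h.le i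
  · intro i
    by_cases e : i = n
    · subst e
      rw [Function.update_self, Function.update_of_ne (by omega), hfa]
    · rw [Function.update_of_ne e]
      by_cases e' : i < n
      · have := h.le i
        rw [Function.update_of_ne (by omega), h.idem]
      · have := h.big i (by omega)
        rw [this, Function.update_of_ne e, this]
  · intro i hi
    rw [Function.update_of_ne (by omega)]
    exact h.big i (by omega)
  · intro b hb
    have := h.lt b hb; omega
  · intro b hb
    have := h.lt b hb
    rw [Function.update_of_ne (by omega)]
    exact h.fixed b hb
  · intro a' b i ha' hab hbi hb hi
    have hne : a' ≠ a := fun e => ha' (e ▸ ha)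
    have hin : i ≠ n := by
      rintro rfl
      rw [Function.update_self] at hi
      exact hne hi.symm
    rw [Function.update_of_ne hin] at hi
    have hin : i < n := by
      by_contra hc
      have := h.big i (by omega)
      omega
    rw [Function.update_of_ne (by omega)] at hb
    have := h.nov a' b i ha' hab hbi hb hi
    refine ⟨this.1, fun j hij hj => ?_⟩
    have hjn : j ≠ n := by
      rintro rfl
      rw [Function.update_self] at hj
      exact this.1 (hj ▸ ha)
    rw [Function.update_of_ne hjn] at hj
    obtain ⟨k, hk, hk'⟩ := this.2 j hij hj
    refine ⟨k, hk, ?_⟩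
    have hkn : k ≠ n := by
      rintro rfl
      rw [h.big k le_rfl] at hk'
      omega
    rw [Function.update_of_ne hkn, hk']

/-- common part of undoing the last step -/
theorem Good.d34 {n f S} (h : Good (n + 1) f S) (hn : f n ≠ n) :
    (∀ i, Function.update f n n i ≤ i) ∧
    (∀ i, Function.update f n n (Function.update f n n i) = Function.update f n n i) ∧
    (∀ i, n ≤ i → Function.update f n n i = i) ∧
    (∀ a ∈ S, a < n) ∧
    (∀ a ∈ S, Function.update f n n a = a) ∧ f n < n ∧
    (∀ i, f i ≠ n) ∧ f (f n) = f n := by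
  have hlt : f n < n := lt_of_le_of_ne (h.le n) hn
  have hnn : ∀ i, f i ≠ n := by
    intro i e
    have := h.idem i
    rw [e] at this
    exact hn this
  have hS : ∀ a ∈ S, a < n := by
    intro a ha
    have := h.lt a ha
    have : a ≠ n := by
      rintro rfl
      exact hn (h.fixed _ ha)
    omega
  refine ⟨?_, ?_, ?_, hS, ?_, hlt, hnn, h.idem n⟩
  · intro i
    rw [Function.update_apply]; split_ifs with e
    · omega
    · exact h.le i
  · intro i
    by_cases e : i = n
    · subst e; simp
    · rw [Function.update_of_ne e, Function.update_of_ne (hnn i), h.idem]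
  · intro i hi
    rw [Function.update_apply]; split_ifs with e
    · omega
    · exact h.big i (by omega)
  · intro a ha
    have := hS a ha
    rw [Function.update_of_ne (by omega)]
    exact h.fixed a ha

theorem Good.d3 {n f S} (h : Good (n + 1) f S) (hn : f n ≠ n) (hS : f n ∈ S) :
    Good n (Function.update f n n) S := by
  obtain ⟨h1, h2, h3, h4, h5, hlt, hnn, hid⟩ := h.d34 hn
  refine ⟨h1, h2, h3, h4, h5, ?_⟩
  intro a b i ha hab hbi hb hi
  have hin : i < n := by
    by_contra hc
    have := h3 i (by omega)
    omega
  rw [Function.update_of_ne (by omega)] at hb hi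
  have := h.nov a b i ha hab hbi hb hi
  refine ⟨this.1, fun j hij hj => ?_⟩
  have hjn : j ≠ n := by
    rintro rfl
    rw [Function.update_self] at hj
    omega
  rw [Function.update_of_ne hjn] at hj
  obtain ⟨k, hk, hk'⟩ := this.2 j hij hj
  refine ⟨k, hk, ?_⟩
  have hkn : k ≠ n := by
    rintro rfl
    exact ha (hk' ▸ hS)
  rw [Function.update_of_ne hkn, hk']

theorem Good.d4 {n f S} (h : Good (n + 1) f S) (hn : f n ≠ n) (hS : f n ∉ S) :
    Good n (Function.update f n n) (insert (f n) S) ∧ ∀ b ∈ S, b < f n := by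
  obtain ⟨h1, h2, h3, h4, h5, hlt, hnn, hid⟩ := h.d34 hn
  refine ⟨⟨h1, h2, h3, ?_, ?_, ?_⟩, ?_⟩
  · intro a ha
    rcases mem_insert.1 ha with rfl | ha
    · exact hlt
    · exact h4 a ha
  · intro a ha
    rcases mem_insert.1 ha with rfl | ha
    · rw [Function.update_of_ne hn, hid]
    · exact h5 a ha
  · intro a b i ha hab hbi hb hi
    rw [mem_insert, not_or] at ha
    have hin : i < n := by
      by_contra hc
      have := h3 i (by omega)
      omega
    rw [Function.update_of_ne (by omega)] at hb hi
    have := h.nov a b i ha.2 hab hbi hb hi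
    have hbn : b ≠ f n := by
      intro e
      obtain ⟨k, hk, hk'⟩ := this.2 n hin e.symm
      have := h.big k (by omega)
      omega
    refine ⟨by rw [mem_insert, not_or]; exact ⟨hbn, this.1⟩, fun j hij hj => ?_⟩
    have hjn : j ≠ n := by
      rintro rfl
      rw [Function.update_self] at hj
      omega
    rw [Function.update_of_ne hjn] at hj
    obtain ⟨k, hk, hk'⟩ := this.2 j hij hj
    refine ⟨k, hk, ?_⟩
    have hkn : k ≠ n := by
      rintro rfl
      exact ha.1 hk'.symm
    rw [Function.update_of_ne hkn, hk']
  · intro b hb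
    by_contra hc
    have hne : b ≠ f n := fun e => hS (e ▸ hb)
    exact (h.nov (f n) b n hS (by omega) (h4 b hb) (h.fixed b hb) rfl).1 hb

theorem Good.c4 {n f S a} (h : Good n f S) (ha : a ∈ S) (hm : ∀ b ∈ S, b ≤ a) :
    Good (n + 1) (Function.update f n a) (S.erase a) := by
  have h' := h.c3 ha
  have han := h.lt a ha
  refine ⟨h'.le, h'.idem, h'.big, fun b hb => h'.lt b (mem_of_mem_erase hb),
    fun b hb => h'.fixed b (mem_of_mem_erase hb), ?_⟩
  intro a' b i ha' hab hbi hb hi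
  by_cases e : a' = a
  · subst e
    refine ⟨fun hh => ?_, fun j hij hj => ⟨n, ?_, by rw [Function.update_self]⟩⟩
    · have := hm b (mem_of_mem_erase hh)
      omega
    · have hjn : j ≠ n := by
        rintro rfl
        rw [Function.update_self] at hj
        omega
      by_contra hc
      have := h'.big j (by omega)
      omega
  · have := h'.nov a' b i (fun hh => ha' (mem_erase.2 ⟨e, hh⟩)) hab hbi hb hi
    exact ⟨fun hh => this.1 (mem_of_mem_erase hh), this.2⟩

noncomputable def AA : ℕ → Finset ((ℕ → ℕ) × Finset ℕ)
  | 0 => {(id, ∅)}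
  | n + 1 => ((AA n ∪ (AA n).image (fun p => (p.1, insert n p.2))) ∪
      ((AA n).biUnion fun p => p.2.image fun a => (Function.update p.1 n a, p.2))) ∪
      ((AA n).filter (fun p => p.2.Nonempty)).image
        (fun p => (Function.update p.1 n (p.2.sup id), p.2.erase (p.2.sup id)))

theorem sup_mem' {S : Finset ℕ} (h : S.Nonempty) : S.sup id ∈ S := by
  obtain ⟨a, ha, e⟩ := Finset.exists_mem_eq_sup S h id
  rw [e]; exact ha

theorem le_sup' {S : Finset ℕ} : ∀ b ∈ S, b ≤ S.sup id := fun b hb => Finset.le_sup (f := id) hb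

theorem mem_AA (n : ℕ) : ∀ f S, (f, S) ∈ AA n ↔ Good n f S := by
  induction n with
  | zero =>
    intro f S
    simp only [AA, mem_singleton, Prod.mk.injEq]
    constructor
    · rintro ⟨rfl, rfl⟩
      refine ⟨fun _ => le_rfl, fun _ => rfl, fun _ _ => rfl, by simp, by simp, ?_⟩
      intro a b i _ hab hbi _ hi
      simp at hi; omega
    · intro h
      refine ⟨funext fun i => h.big i (by omega), ?_⟩
      rw [Finset.eq_empty_iff_forall_notMem]
      intro a ha
      have := h.lt a ha; omega
  | succ n ih =>
    intro f S
    simp only [AA, mem_union, mem_image, mem_biUnion, mem_filter, Prod.exists, Prod.mk.injEq]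
    constructor
    · rintro (((h | ⟨f', S', h, rfl, rfl⟩) | ⟨f', S', h, a, ha, rfl, rfl⟩) | ⟨f', S', ⟨h, hne⟩, rfl, rfl⟩)
      · exact ((ih _ _).1 h).c1
      · exact ((ih _ _).1 h).c2
      · exact ((ih _ _).1 h).c3 ha
      · exact ((ih _ _).1 h).c4 (sup_mem' hne) le_sup'
    · intro h
      by_cases hn : f n = n
      · by_cases hS : n ∈ S
        · exact Or.inl (Or.inl (Or.inr ⟨f, S.erase n, (ih _ _).2 (h.d2 hn), rfl, insert_erase hS⟩))
        · exact Or.inl (Or.inl (Or.inl ((ih _ _).2 (h.d1 hn hS))))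
      · by_cases hS : f n ∈ S
        · exact Or.inl (Or.inr ⟨_, S, (ih _ _).2 (h.d3 hn hS), f n, hS, by simp, rfl⟩)
        · obtain ⟨hg, hb⟩ := h.d4 hn hS
          have hsup : (insert (f n) S).sup id = f n := by
            apply le_antisymm
            · apply Finset.sup_le
              intro b hb'
              rcases mem_insert.1 hb' with rfl | hb'
              · exact le_rfl
              · exact (hb b hb').le
            · exact le_sup' _ (mem_insert_self _ _)
          refine Or.inr ⟨_, _, ⟨(ih _ _).2 hg, insert_nonempty _ _⟩, ?_, ?_⟩
          · rw [hsup]; simp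
          · rw [hsup, erase_insert hS]

theorem upd_inj {n : ℕ} {f f' : ℕ → ℕ} {a a' : ℕ} (hf : f n = n) (hf' : f' n = n)
    (h : Function.update f n a = Function.update f' n a') : f = f' ∧ a = a' := by
  constructor
  · funext i
    by_cases e : i = n
    · rw [e, hf, hf']
    · have := congrFun h i
      rwa [Function.update_of_ne e, Function.update_of_ne e] at this
  · have := congrFun h n
    rwa [Function.update_self, Function.update_self] at this

theorem sum_AA (n : ℕ) (g : ℕ → ℚ) : ∑ p ∈ AA (n + 1), g p.2.card =
    ∑ p ∈ AA n, ((p.2.card + 1) * g p.2.card + g (p.2.card + 1) +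
      if p.2.card = 0 then 0 else g (p.2.card - 1)) := by
  have hG : ∀ p ∈ AA n, Good n p.1 p.2 := fun p hp => (mem_AA n p.1 p.2).1 hp
  have hfn : ∀ p ∈ AA n, p.1 n = n := fun p hp => (hG p hp).big n le_rfl
  have hnS : ∀ p ∈ AA n, n ∉ p.2 := fun p hp h => absurd ((hG p hp).lt n h) (lt_irrefl _)
  rw [AA, Finset.sum_union, Finset.sum_union, Finset.sum_union, Finset.sum_image,
    Finset.sum_biUnion, Finset.sum_image, Finset.sum_filter, ← Finset.sum_add_distrib,
    ← Finset.sum_add_distrib, ← Finset.sum_add_distrib]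
  · refine Finset.sum_congr rfl fun p hp => ?_
    have e3 : ∑ q ∈ p.2.image (fun a => (Function.update p.1 n a, p.2)), g q.2.card =
        p.2.card * g p.2.card := by
      rw [Finset.sum_image]
      · simp
      · intro a _ b _ hab
        exact (upd_inj (hfn p hp) (hfn p hp) (Prod.mk.inj hab).1).2
    rw [e3]
    simp only [card_insert_of_notMem (hnS p hp)]
    by_cases hne : p.2.Nonempty
    · rw [if_pos hne, if_neg (by simpa [Finset.nonempty_iff_ne_empty] using hne),
        card_erase_of_mem (sup_mem' hne)]
      ring
    · rw [if_neg hne, if_pos (by simpa [Finset.nonempty_iff_ne_empty] using hne)]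
      ring
  · rintro p hp q hq hpq
    simp only [mem_coe, mem_filter] at hp hq
    obtain ⟨h1, h2⟩ := Prod.mk.inj hpq
    obtain ⟨h3, h4⟩ := upd_inj (hfn p hp.1) (hfn q hq.1) h1
    refine Prod.ext h3 ?_
    rw [← insert_erase (sup_mem' hp.2), h2, h4, insert_erase (sup_mem' hq.2)]
  · intro p hp q hq hpq
    simp only [Function.onFun]
    rw [Finset.disjoint_left]
    intro r hr hr'
    simp only [mem_image] at hr hr'
    obtain ⟨a, ha, rfl⟩ := hr
    obtain ⟨b, hb, e⟩ := hr'
    obtain ⟨h1, h2⟩ := Prod.mk.inj e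
    exact hpq (Prod.ext (upd_inj (hfn q hq) (hfn p hp) h1).1.symm h2.symm)
  · intro p hp q hq hpq
    obtain ⟨h1, h2⟩ := Prod.mk.inj hpq
    refine Prod.ext h1 ?_
    rw [← erase_insert (hnS p hp), h2, erase_insert (hnS q hq)]
  · rw [Finset.disjoint_left]
    intro r hr hr'
    simp only [mem_image] at hr'
    obtain ⟨q, hq, rfl⟩ := hr'
    exact hnS _ hr (mem_insert_self _ _)
  · rw [Finset.disjoint_left]
    intro r hr hr'
    simp only [mem_image, mem_biUnion] at hr'
    obtain ⟨q, hq, a, ha, rfl⟩ := hr'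
    have hlt := (hG q hq).lt a ha
    have : Function.update q.1 n a n = n := by
      rcases mem_union.1 hr with hr | hr
      · exact hfn _ hr
      · obtain ⟨s, hs, e⟩ := mem_image.1 hr
        rw [← (Prod.mk.inj e).1]
        exact hfn s hs
    rw [Function.update_self] at this
    omega
  · rw [Finset.disjoint_left]
    intro r hr hr'
    simp only [mem_image, mem_filter] at hr'
    obtain ⟨q, ⟨hq, hne⟩, rfl⟩ := hr'
    have hlt := (hG q hq).lt _ (sup_mem' hne)
    rcases mem_union.1 hr with hr | hr
    · have : Function.update q.1 n (q.2.sup id) n = n := by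
        rcases mem_union.1 hr with hr | hr
        · exact hfn _ hr
        · obtain ⟨s, hs, e⟩ := mem_image.1 hr
          rw [← (Prod.mk.inj e).1]
          exact hfn s hs
      rw [Function.update_self] at this
      omega
    · simp only [mem_image, mem_biUnion] at hr
      obtain ⟨s, hs, a, ha, e⟩ := hr
      obtain ⟨h1, h2⟩ := Prod.mk.inj e
      have := (upd_inj (hfn s hs) (hfn q hq) h1).2
      rw [h2, this] at ha
      exact notMem_erase _ _ ha

theorem sum_AA_Wt (n : ℕ) : ∀ k, ∑ p ∈ AA n, Wt k p.2.card = Wt (n + k) 0 := by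
  induction n with
  | zero => intro k; simp [AA]
  | succ n ih =>
    intro k
    rw [sum_AA, show n + 1 + k = n + (k + 1) by omega, ← ih (k + 1)]
    rfl

theorem card_AA (n : ℕ) : (((AA n).filter (fun p => p.2 = ∅)).card : ℚ) = Wt n 0 := by
  have := sum_AA_Wt n 0
  rw [add_zero] at this
  rw [← this, Finset.card_filter]
  push_cast
  refine Finset.sum_congr rfl fun p _ => ?_
  simp [Wt]

/-! Partitions versus functions. -/

noncomputable def toF {n : ℕ} (π : Finpartition (univ : Finset (Fin n))) (i : ℕ) : ℕ :=
  if h : i < n then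
    ((π.part ⟨i, h⟩).min' (by simp) : Fin n) else i

theorem toF_of_mem {n : ℕ} (π : Finpartition (univ : Finset (Fin n))) {α : Finset (Fin n)}
    (hα : α ∈ π.parts) (i : Fin n) (hi : i ∈ α) : toF π i = (α.min' ⟨i, hi⟩ : Fin n) := by
  have : π.part i = α := π.part_eq_of_mem hα hi
  subst this
  simp [toF]

theorem toF_eq_iff {n : ℕ} (π : Finpartition (univ : Finset (Fin n))) (i j : Fin n) :
    toF π i = toF π j ↔ i ∈ π.part j := by
  have hi : i ∈ π.part i := by simp
  have hj : j ∈ π.part j := by simp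
  have hpi : π.part i ∈ π.parts := by simp
  have hpj : π.part j ∈ π.parts := by simp
  constructor
  · intro h
    rw [toF_of_mem π hpi i hi, toF_of_mem π hpj j hj] at h
    have h1 := (π.part i).min'_mem ⟨i, hi⟩
    rw [Fin.ext h] at h1
    have := π.eq_of_mem_parts hpi hpj h1 ((π.part j).min'_mem ⟨j, hj⟩)
    rwa [← this]
  · intro h
    rw [toF_of_mem π hpj i h, toF_of_mem π hpj j hj]

theorem toF_good {n : ℕ} (π : Finpartition (univ : Finset (Fin n))) (hπ : IsNOP π) :
    Good n (toF π) ∅ := by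
  have hlen : ∀ i, n ≤ i → toF π i = i := fun i hi => by
    rw [toF, dif_neg (by omega)]
  have key : ∀ i : Fin n, ∃ α, ∃ _ : α ∈ π.parts, ∃ hi : i ∈ α,
      toF π i = (α.min' ⟨i, hi⟩ : Fin n) := fun i =>
    ⟨π.part i, by simp, by simp, toF_of_mem π (by simp) i (by simp)⟩
  have hle : ∀ i, toF π i ≤ i := by
    intro i
    by_cases h : i < n
    · obtain ⟨α, hα, hi, e⟩ := key ⟨i, h⟩
      simp only at e
      rw [e]
      exact α.min'_le _ hi
    · exact (hlen i (by omega)).le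
  refine ⟨hle, ?_, hlen, by simp, by simp, ?_⟩
  · intro i
    by_cases h : i < n
    · obtain ⟨α, hα, hi, e⟩ := key ⟨i, h⟩
      simp only at e
      rw [e]
      exact toF_of_mem π hα _ (α.min'_mem ⟨_, hi⟩)
    · rw [hlen i (by omega), hlen i (by omega)]
  · intro a b i _ hab hbi hb hi
    refine ⟨by simp, fun j hij hj => ?_⟩
    by_contra hc
    push Not at hc
    have hjn : j < n := by
      by_contra hh
      have := hlen j (by omega)
      omega
    obtain ⟨α, hα, hiα, e⟩ := key ⟨i, by omega⟩
    obtain ⟨β, hβ, hjβ, e'⟩ := key ⟨j, hjn⟩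
    simp only at e e'
    refine hπ α hα β hβ ⟨⟨_, hiα⟩, ⟨_, hjβ⟩, ?_, ?_, ?_⟩
    · rw [Fin.lt_def]; omega
    · have : i ≤ (α.max' ⟨_, hiα⟩ : Fin n) := α.le_max' _ hiα
      rw [Fin.lt_def]; omega
    · have h1 : j ≤ (β.max' ⟨_, hjβ⟩ : Fin n) := β.le_max' _ hjβ
      have h2 := toF_of_mem π hα _ (α.max'_mem ⟨_, hiα⟩)
      have h3 : ¬ j < (α.max' ⟨_, hiα⟩ : Fin n) := by
        intro h
        exact hc _ h (by rw [h2]; omega)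
      have h4 : j ≠ (α.max' ⟨_, hiα⟩ : Fin n) := by
        intro h
        rw [← h] at h2
        omega
      rw [Fin.lt_def]; omega

theorem good_toF {n : ℕ} (π : Finpartition (univ : Finset (Fin n))) (h : Good n (toF π) ∅) :
    IsNOP π := by
  rintro α hα β hβ ⟨hα', hβ', h1, h2, h3⟩
  have ea := toF_of_mem π hα _ (α.max'_mem hα')
  have eb := toF_of_mem π hβ _ (β.max'_mem hβ')
  have eb' := toF_of_mem π hβ _ (β.min'_mem hβ')
  obtain ⟨k, hk, hk'⟩ := (h.nov _ _ _ (by simp) h1 h2 eb' ea).2 _ h3 eb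
  have hkn : k < n := by
    by_contra hh
    have := h.big k (by omega)
    have := (α.min' hα').2
    omega
  have hkα : (⟨k, hkn⟩ : Fin n) ∈ π.part (α.max' hα') := by
    rw [← toF_eq_iff, ea]
    exact hk'
  rw [π.part_eq_of_mem hα (α.max'_mem hα')] at hkα
  have := α.le_max' _ hkα
  rw [Fin.le_def] at this
  rw [Fin.lt_def] at h3
  simp only at this
  omega

theorem card_NOP (n : ℕ) :
    (univ.filter (fun π : Finpartition (univ : Finset (Fin n)) => IsNOP π)).card =
      ((AA n).filter (fun p => p.2 = ∅)).card := by
  refine Finset.card_bij (fun π _ => (toF π, ∅)) ?_ ?_ ?_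
  · intro π hπ
    rw [mem_filter] at hπ ⊢
    exact ⟨(mem_AA _ _ _).2 (toF_good π hπ.2), rfl⟩
  · intro π _ ρ _ h
    have h' : toF π = toF ρ := (Prod.mk.inj h).1
    have hp : ∀ j, π.part j = ρ.part j := by
      intro j
      ext i
      rw [← toF_eq_iff, ← toF_eq_iff, h']
    ext α
    constructor
    · intro hα
      obtain ⟨i, hi⟩ := π.nonempty_of_mem_parts hα
      rw [← π.part_eq_of_mem hα hi, hp]
      simp
    · intro hα
      obtain ⟨i, hi⟩ := ρ.nonempty_of_mem_parts hα
      rw [← ρ.part_eq_of_mem hα hi, ← hp]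
      simp
  · rintro ⟨f, S⟩ hp
    rw [mem_filter] at hp
    obtain ⟨hp, hS⟩ := hp
    simp only at hS
    subst hS
    have hg := (mem_AA _ _ _).1 hp
    let s : Setoid (Fin n) := Setoid.ker (fun i : Fin n => f i)
    let π := Finpartition.ofSetoid s
    have hf : toF π = f := by
      funext i
      by_cases h : i < n
      · rw [toF, dif_pos h]
        have hfi : f i < n := lt_of_le_of_lt (hg.le i) h
        have hm : (⟨f i, hfi⟩ : Fin n) ∈ π.part ⟨i, h⟩ := by
          rw [Finpartition.mem_part_ofSetoid_iff_rel]
          exact (hg.idem i).symm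
        apply le_antisymm
        · exact (π.part ⟨i, h⟩).min'_le _ hm
        · have := (π.part ⟨i, h⟩).min'_mem ⟨_, hm⟩
          rw [Finpartition.mem_part_ofSetoid_iff_rel] at this
          have e : f i = f ((π.part ⟨i, h⟩).min' ⟨_, hm⟩ : Fin n) := this
          rw [e]
          exact hg.le _
      · rw [toF, dif_neg h, hg.big i (by omega)]
    refine ⟨π, ?_, by rw [hf]⟩
    rw [mem_filter]
    exact ⟨mem_univ _, good_toF π (by rw [hf]; exact hg)⟩

/-- The `n`-th Bessel number, i.e. the total number of non-overlapping set partitions of `[n]`,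
equals the value at `u = 1` of the polynomial `F (n+1)`, where `F 1 = u` and
`F (m+1) = u·(F m)' + Σ_{s=1}^{m−1} (F s)·(F (m−s))`. -/
theorem bessel_number_eq_eval_one
    (F : ℕ → Polynomial ℚ)
    (hF1 : F 1 = X)
    (hF : ∀ m, 1 ≤ m →
      F (m + 1) = X * derivative (F m) + ∑ s ∈ Icc 1 (m - 1), F s * F (m - s))
    (n : ℕ) :
    ((univ.filter (fun π : Finpartition (univ : Finset (Fin n)) => IsNOP π)).card : ℚ)
      = (F (n + 1)).eval 1 := by
  rw [card_NOP, card_AA, Wt_eq, F_eq F hF1 hF n]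
  simp
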